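/- There exists a constant C > 0 (the constant from the logarithmic Hardy–Littlewood–Sobolev inequality) such that the following holds: for every S > 0 and every bounded measurable σ : ℝ² → ℝ, not identically zero, with σ(x) = 0 for almost every |x| > S and ∫_{ℝ²} σ(x) dx = 0, one has −∫_{ℝ²}∫_{ℝ²} ln|x−y| σ(y) σ(x) dy dx ≤ (1/2) ‖σ‖_{L¹} ∫_{ℝ²} |σ(x)| ln( |σ(x)| / ‖σ‖_{L¹} ) dx + ( C + ln(2S) ) ‖σ‖_{L¹}². -/

import Mathlib

open MeasureTheory Real

noncomputable section

abbrev E2 : Type := EuclideanSpace ℝ (Fin 2)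

/-- `C` is a constant for the logarithmic Hardy–Littlewood–Sobolev inequality on `ℝ²`:
for every a.e. non-negative `ρ ∈ L¹(ℝ²)` with finite logarithmic moment (and with the
entropy and double integrals well defined),
`-∫∫ ln|x-y| ρ(y) ρ(x) dy dx ≤ (1/2)‖ρ‖₁ ∫ ρ ln(ρ/‖ρ‖₁) + C‖ρ‖₁²`. -/
def IsLogHLSConstant (C : ℝ) : Prop :=
  ∀ ρ : E2 → ℝ, Integrable ρ →
    (∀ᵐ x ∂(volume : Measure E2), 0 ≤ ρ x) →
    Integrable (fun x : E2 => ρ x * Real.log (1 + ‖x‖ ^ 2)) →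
    Integrable (fun x : E2 => ρ x * Real.log (ρ x / ∫ x' : E2, ρ x')) →
    Integrable (fun z : E2 × E2 => Real.log ‖z.1 - z.2‖ * ρ z.1 * ρ z.2) →
    -∫ x : E2, ∫ y : E2, Real.log ‖x - y‖ * ρ y * ρ x ≤
      (1/2) * (∫ x : E2, ρ x) * (∫ x : E2, ρ x * Real.log (ρ x / ∫ x' : E2, ρ x'))
        + C * (∫ x : E2, ρ x) ^ 2

def hh (t : ℝ) : ℝ := if t ≤ 1 then 2 / t else 2 / t ^ 4

lemma hh_nonneg {t : ℝ} (ht : 0 ≤ t) : 0 ≤ hh t := by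
  unfold hh; split_ifs <;> positivity

lemma hh_meas : Measurable hh := by
  unfold hh
  exact Measurable.ite measurableSet_Iic (by fun_prop) (by fun_prop)

lemma pw_aux {q Q n : ℝ} (hq : 0 < q) (hqQ : q ≤ Q) (hn : 0 < n) :
    q ^ 4 * (-2 * Real.log (n * Q * q)) ≤ Q ^ 4 * hh (Q ^ 2 * n) := by
  have hQ : 0 < Q := hq.trans_le hqQ
  have ha : 0 < n * Q * q := by positivity
  unfold hh
  split_ifs with h
  · have h1 : -Real.log (n * Q * q) ≤ 1 / (n * Q * q) := by
      rw [← Real.log_inv, one_div]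
      exact (Real.log_le_sub_one_of_pos (by positivity)).trans (by linarith)
    calc q ^ 4 * (-2 * Real.log (n * Q * q)) = 2 * q ^ 4 * (-Real.log (n * Q * q)) := by ring
      _ ≤ 2 * q ^ 4 * (1 / (n * Q * q)) := by gcongr
      _ = 2 * q ^ 3 / (n * Q) := by field_simp
      _ ≤ 2 * Q ^ 3 / (n * Q) := by gcongr
      _ = Q ^ 4 * (2 / (Q ^ 2 * n)) := by field_simp
  · have h1 : -(4 * Real.log (n * Q * q)) ≤ 1 / (n * Q * q) ^ 4 := by
      have : 4 * Real.log (n * Q * q) = Real.log ((n * Q * q) ^ 4) := by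
        rw [Real.log_pow]; norm_num
      rw [this, ← Real.log_inv, one_div]
      exact (Real.log_le_sub_one_of_pos (by positivity)).trans (by linarith)
    calc q ^ 4 * (-2 * Real.log (n * Q * q)) = q ^ 4 / 2 * (-(4 * Real.log (n * Q * q))) := by ring
      _ ≤ q ^ 4 / 2 * (1 / (n * Q * q) ^ 4) := by gcongr
      _ = 1 / (2 * n ^ 4 * Q ^ 4) := by field_simp
      _ ≤ 2 / (n ^ 4 * Q ^ 4) := by
        rw [div_le_div_iff₀ (by positivity) (by positivity)]
        have : 0 < n ^ 4 * Q ^ 4 := by positivity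
        nlinarith
      _ = Q ^ 4 * (2 / (Q ^ 2 * n) ^ 4) := by field_simp

lemma pw1 {r R n : ℝ} (hr : 0 ≤ r) (hrR : r ≤ R) (hn : 0 < n) :
    -2 * Real.log n * (R * r) ≤ 1 / 2 * (R * r) * (Real.log R + Real.log r)
      + R * (R * hh (√R * n)) := by
  have hR := hr.trans hrR
  have hh0 : 0 ≤ hh (√R * n) := hh_nonneg (by positivity)
  rcases hr.eq_or_lt with rfl | hr0
  · simp; positivity
  have hR0 := hr0.trans_le hrR
  have key := pw_aux (q := √√r) (Q := √√R) (n := n) (by positivity) (by gcongr) hn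
  have e1 : ∀ s : ℝ, 0 ≤ s → √√s ^ 2 = √s := fun s hs => Real.sq_sqrt (by positivity)
  have e2 : ∀ s : ℝ, 0 ≤ s → √√s ^ 4 = s := fun s hs => by
    rw [show (4:ℕ) = 2 * 2 from rfl, pow_mul, e1 s hs, Real.sq_sqrt hs]
  rw [e1 R hR, e2 R hR, e2 r hr, Real.log_mul (by positivity) (by positivity),
    Real.log_mul (by positivity) (by positivity), Real.log_sqrt (by positivity),
    Real.log_sqrt (by positivity), Real.log_sqrt (by positivity), Real.log_sqrt (by positivity)] at key
  nlinarith [mul_le_mul_of_nonneg_left key hR]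

lemma pw2 {r R n : ℝ} (hr : 0 ≤ r) (hR : 0 ≤ R) (hn : 0 < n) :
    -2 * Real.log n * (R * r) ≤ 1 / 2 * (R * r) * (Real.log R + Real.log r)
      + R * (R * hh (√R * n)) + r * (r * hh (√r * n)) := by
  have h1 : 0 ≤ r * (r * hh (√r * n)) := by
    have := hh_nonneg (t := √r * n) (by positivity)
    positivity
  have h2 : 0 ≤ R * (R * hh (√R * n)) := by
    have := hh_nonneg (t := √R * n) (by positivity)
    positivity
  rcases le_total r R with h | h
  · linarith [pw1 hr h hn]
  · have := pw1 hR h hn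
    rw [mul_comm r R, add_comm (Real.log r)] at this
    linarith

lemma hh_int : Integrable (fun x : E2 => hh ‖x‖) := by
  rw [integrable_fun_norm_addHaar (μ := (volume : Measure E2)) (f := hh)]
  simp only [finrank_euclideanSpace, Fintype.card_fin, smul_eq_mul]
  norm_num
  rw [← Set.Ioc_union_Ioi_eq_Ioi (zero_le_one' ℝ)]
  refine IntegrableOn.union ?_ ?_
  · have : IntegrableOn (fun _ : ℝ => (2:ℝ)) (Set.Ioc 0 1) := by
      apply integrableOn_const; simp; simp
    refine this.congr_fun (fun y hy => ?_) measurableSet_Ioc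
    have := hy.1
    simp [hh, hy.2]; field_simp
  · have : IntegrableOn (fun y : ℝ => 2 * y ^ (-3:ℝ)) (Set.Ioi 1) :=
      (integrableOn_Ioi_rpow_of_lt (by norm_num) one_pos).const_mul 2
    refine this.congr_fun (fun y hy => ?_) measurableSet_Ioi
    have h1 : (1:ℝ) < y := hy
    have h0 : 0 < y := by linarith
    simp only [hh, not_le.mpr h1, if_false]
    rw [Real.rpow_neg h0.le]
    norm_cast
    field_simp

lemma logq_int (S : ℝ) : Integrable
    (fun x : E2 => Set.indicator (Set.Iic (2 * S)) (fun t => |Real.log t|) ‖x‖) := by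
  rw [integrable_fun_norm_addHaar (μ := (volume : Measure E2))
    (f := Set.indicator (Set.Iic (2 * S)) (fun t => |Real.log t|))]
  simp only [finrank_euclideanSpace, Fintype.card_fin, smul_eq_mul]
  norm_num
  have hm : Measurable (fun y : ℝ => y * Set.indicator (Set.Iic (2 * S)) (fun t => |Real.log t|) y) :=
    measurable_id.mul (Measurable.indicator (by fun_prop) measurableSet_Iic)
  have hc : Continuous (fun y : ℝ => |y * Real.log y|) := Real.continuous_mul_log.abs
  have hI : Integrable (Set.indicator (Set.Icc 0 (2 * S)) (fun y : ℝ => |y * Real.log y|)) :=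
    (hc.integrableOn_Icc).integrable_indicator measurableSet_Icc
  refine (hI.integrableOn (s := Set.Ioi 0)).congr_fun (fun y hy => ?_) measurableSet_Ioi
  have h0 : (0:ℝ) < y := hy
  by_cases h : y ≤ 2 * S
  · simp [Set.indicator, h, h0.le, abs_mul, abs_of_pos h0]
  · simp [Set.indicator, h]

def KK : ℝ := ∫ x : E2, hh ‖x‖

lemma KK_nonneg : 0 ≤ KK := integral_nonneg fun x => hh_nonneg (norm_nonneg _)

lemma sl_int (R : ℝ) (hR : 0 ≤ R) (x : E2) :
    Integrable (fun y : E2 => R * hh (√R * ‖x - y‖)) ∧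
      ∫ y : E2, R * hh (√R * ‖x - y‖) ≤ KK := by
  rcases hR.eq_or_lt with rfl | h
  · simpa using KK_nonneg
  have hs : √R ≠ 0 := by positivity
  have e : ∀ z : E2, hh (√R * ‖z‖) = hh ‖√R • z‖ := fun z => by
    rw [norm_smul, Real.norm_of_nonneg (Real.sqrt_nonneg _)]
  have hi : Integrable (fun z : E2 => hh (√R * ‖z‖)) := by
    simp_rw [e]; exact hh_int.comp_smul hs
  refine ⟨(hi.comp_sub_left x).const_mul R, ?_⟩
  rw [integral_const_mul, integral_sub_left_eq_self (fun z : E2 => hh (√R * ‖z‖)) volume x]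
  simp_rw [e]
  rw [Measure.integral_comp_smul volume (fun z : E2 => hh ‖z‖)]
  simp only [finrank_euclideanSpace, Fintype.card_fin, smul_eq_mul]
  rw [Real.sq_sqrt hR, abs_of_pos (by positivity), ← mul_assoc, mul_inv_cancel₀ h.ne', one_mul]
  rfl

lemma H_int (p : E2 → ℝ) (hp : Integrable p) (h0 : ∀ᵐ x ∂(volume : Measure E2), 0 ≤ p x) :
    Integrable (fun z : E2 × E2 => p z.1 * (p z.1 * hh (√(p z.1) * ‖z.1 - z.2‖)))
      ((volume : Measure E2).prod volume) ∧
    ∫ z : E2 × E2, p z.1 * (p z.1 * hh (√(p z.1) * ‖z.1 - z.2‖))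
      ∂((volume : Measure E2).prod volume) ≤ (∫ x, p x) * KK := by
  have hm : AEMeasurable (fun z : E2 × E2 => p z.1) ((volume : Measure E2).prod volume) :=
    hp.aestronglyMeasurable.aemeasurable.comp_fst
  have hm2 : AEStronglyMeasurable
      (fun z : E2 × E2 => p z.1 * (p z.1 * hh (√(p z.1) * ‖z.1 - z.2‖)))
      ((volume : Measure E2).prod volume) := by
    refine (hm.mul (hm.mul (hh_meas.comp_aemeasurable (AEMeasurable.mul ?_ ?_)))).aestronglyMeasurable
    · exact Real.continuous_sqrt.measurable.comp_aemeasurable hm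
    · exact (by fun_prop : Measurable (fun z : E2 × E2 => ‖z.1 - z.2‖)).aemeasurable
  have hb : ∀ᵐ x ∂(volume : Measure E2),
      ∫ y : E2, p x * (p x * hh (√(p x) * ‖x - y‖)) ≤ p x * KK := by
    filter_upwards [h0] with x hx
    rw [integral_const_mul]
    exact mul_le_mul_of_nonneg_left (sl_int (p x) hx x).2 hx
  have hpos : ∀ᵐ x ∂(volume : Measure E2), ∀ y : E2,
      0 ≤ p x * (p x * hh (√(p x) * ‖x - y‖)) := by
    filter_upwards [h0] with x hx y
    have := hh_nonneg (t := √(p x) * ‖x - y‖) (by positivity)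
    positivity
  have hI : Integrable (fun z : E2 × E2 => p z.1 * (p z.1 * hh (√(p z.1) * ‖z.1 - z.2‖)))
      ((volume : Measure E2).prod volume) := by
    rw [integrable_prod_iff hm2]
    constructor
    · filter_upwards [h0] with x hx
      exact (sl_int (p x) hx x).1.const_mul _
    · refine (hp.mul_const KK).mono' hm2.norm.integral_prod_right' ?_
      filter_upwards [hb, hpos] with x h1 h2
      rw [Real.norm_of_nonneg (integral_nonneg fun y => norm_nonneg _)]
      refine le_trans (le_of_eq ?_) h1
      exact integral_congr_ae (.of_forall fun y => Real.norm_of_nonneg (h2 y))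
  refine ⟨hI, ?_⟩
  rw [integral_prod _ hI, ← integral_mul_const]
  exact integral_mono_ae hI.integral_prod_left (hp.mul_const _) hb

lemma ne_ae : ∀ᵐ z ∂((volume : Measure E2).prod volume), 0 < ‖z.1 - z.2‖ := by
  rw [Measure.ae_prod_iff_ae_ae]
  · refine .of_forall fun x => ?_
    have : ∀ᵐ y ∂(volume : Measure E2), y ≠ x := by
      simp [ae_iff]
    filter_upwards [this] with y hy
    exact norm_pos_iff.mpr (sub_ne_zero.mpr hy.symm)
  · exact measurableSet_lt measurable_const (by fun_prop)

lemma hls_one (p : E2 → ℝ) (hp : Integrable p) (h0 : ∀ᵐ x ∂(volume : Measure E2), 0 ≤ p x)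
    (h1 : ∫ x, p x = 1) (hent : Integrable (fun x => p x * Real.log (p x)))
    (hF : Integrable (fun z : E2 × E2 => Real.log ‖z.1 - z.2‖ * (p z.1 * p z.2))
      ((volume : Measure E2).prod volume)) :
    -∫ z : E2 × E2, Real.log ‖z.1 - z.2‖ * (p z.1 * p z.2)
      ∂((volume : Measure E2).prod volume) ≤ 1 / 2 * (∫ x, p x * Real.log (p x)) + KK := by
  obtain ⟨hH, hHle⟩ := H_int p hp h0
  have hH' := hH.swap
  have hHle' : ∫ z : E2 × E2, p z.2 * (p z.2 * hh (√(p z.2) * ‖z.1 - z.2‖))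
      ∂((volume : Measure E2).prod volume) ≤ (∫ x, p x) * KK := by
    refine le_trans (le_of_eq ?_) hHle
    rw [← integral_prod_swap]
    simp only [Prod.fst_swap, Prod.snd_swap]
    simp_rw [norm_sub_rev]
  have hH2 : Integrable (fun z : E2 × E2 => p z.2 * (p z.2 * hh (√(p z.2) * ‖z.1 - z.2‖)))
      ((volume : Measure E2).prod volume) := by
    refine hH'.congr (.of_forall fun z => ?_)
    simp [norm_sub_rev]
  have hA : Integrable (fun z : E2 × E2 => (p z.1 * Real.log (p z.1)) * p z.2)
      ((volume : Measure E2).prod volume) := hent.mul_prod hp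
  have hB : Integrable (fun z : E2 × E2 => p z.1 * (p z.2 * Real.log (p z.2)))
      ((volume : Measure E2).prod volume) := hp.mul_prod hent
  have hle : ∀ᵐ z ∂((volume : Measure E2).prod volume),
      -2 * (Real.log ‖z.1 - z.2‖ * (p z.1 * p z.2)) ≤
      (1 / 2 * ((p z.1 * Real.log (p z.1)) * p z.2) + 1 / 2 * (p z.1 * (p z.2 * Real.log (p z.2))))
      + (p z.1 * (p z.1 * hh (√(p z.1) * ‖z.1 - z.2‖)) +
        p z.2 * (p z.2 * hh (√(p z.2) * ‖z.1 - z.2‖))) := by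
    filter_upwards [ne_ae, Measure.quasiMeasurePreserving_fst.ae h0,
      Measure.quasiMeasurePreserving_snd.ae h0] with z hz hz1 hz2
    have := pw2 hz2 hz1 hz
    linarith
  have := integral_mono_ae (hF.const_mul (-2))
    (((hA.const_mul (1/2)).add (hB.const_mul (1/2))).add (hH.add hH2)) hle
  simp only [Pi.add_apply] at this
  rw [integral_const_mul, integral_add, integral_add, integral_add,
    integral_const_mul, integral_const_mul, integral_prod_mul (fun x => p x * Real.log (p x)) p,
    integral_prod_mul p (fun x => p x * Real.log (p x)), h1] at this
  · rw [h1] at hHle hHle'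
    linarith
  all_goals first
    | exact hH | exact hH2 | exact hA.const_mul _ | exact hB.const_mul _
    | exact (hA.const_mul _).add (hB.const_mul _) | exact hH.add hH2

lemma hls (C : ℝ) (hC : KK ≤ C) : IsLogHLSConstant C := by
  intro ρ hρ h0 _ hent hF
  set M := ∫ x : E2, ρ x with hM
  have hM0 : 0 ≤ M := integral_nonneg_of_ae h0
  have hF' : Integrable (fun z : E2 × E2 => Real.log ‖z.1 - z.2‖ * ρ z.2 * ρ z.1)
      ((volume : Measure E2).prod volume) :=
    hF.congr (.of_forall fun z => by ring)
  rcases hM0.eq_or_lt with h | h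
  · have hz : ρ =ᵐ[volume] 0 := (integral_eq_zero_iff_of_nonneg_ae h0 hρ).1 h.symm
    have : ∫ x : E2, ∫ y : E2, Real.log ‖x - y‖ * ρ y * ρ x = 0 := by
      apply integral_eq_zero_of_ae
      filter_upwards [hz] with x hx
      simp [hx]
    rw [this, ← h]; simp
  have key := hls_one (fun x => M⁻¹ * ρ x) (hρ.const_mul _)
    (by filter_upwards [h0] with x hx; positivity)
    (by rw [integral_const_mul, ← hM, inv_mul_cancel₀ h.ne'])
    ((hent.const_mul M⁻¹).congr (.of_forall fun x => by
      simp only []; rw [div_eq_inv_mul]; ring))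
    ((hF.const_mul (M⁻¹ * M⁻¹)).congr (.of_forall fun z => by simp only []; ring))
  have e1 : ∫ z : E2 × E2, Real.log ‖z.1 - z.2‖ * (M⁻¹ * ρ z.1 * (M⁻¹ * ρ z.2))
      ∂((volume : Measure E2).prod volume)
      = M⁻¹ * M⁻¹ * ∫ x : E2, ∫ y : E2, Real.log ‖x - y‖ * ρ y * ρ x := by
    rw [← integral_prod _ hF', ← integral_const_mul]
    congr 1; ext z; ring
  have e2 : ∫ x : E2, M⁻¹ * ρ x * Real.log (M⁻¹ * ρ x)
      = M⁻¹ * ∫ x : E2, ρ x * Real.log (ρ x / M) := by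
    rw [← integral_const_mul]
    congr 1; ext x; rw [div_eq_inv_mul]; ring
  rw [e1, e2] at key
  have k2 := mul_le_mul_of_nonneg_left key (sq_nonneg M)
  have e3 : M ^ 2 * -(M⁻¹ * M⁻¹ * ∫ x : E2, ∫ y : E2, Real.log ‖x - y‖ * ρ y * ρ x)
    = -∫ x : E2, ∫ y : E2, Real.log ‖x - y‖ * ρ y * ρ x := by field_simp
  have e4 : M ^ 2 * (1 / 2 * (M⁻¹ * ∫ x : E2, ρ x * Real.log (ρ x / M)) + KK) =
    1 / 2 * M * (∫ x : E2, ρ x * Real.log (ρ x / M)) + KK * M ^ 2 := by field_simp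
  rw [e3, e4] at k2
  nlinarith [mul_le_mul_of_nonneg_right hC (sq_nonneg M)]

theorem stmt17 :
    ∃ C > (0:ℝ), IsLogHLSConstant C ∧
      ∀ S : ℝ, 0 < S → ∀ σ : E2 → ℝ, Measurable σ → (∃ M : ℝ, ∀ x, |σ x| ≤ M) →
        ¬(∀ᵐ x ∂(volume : Measure E2), σ x = 0) →
        (∀ᵐ x ∂(volume : Measure E2), S < ‖x‖ → σ x = 0) →
        (∫ x : E2, σ x) = 0 →
        ∫ x : E2, ∫ y : E2, (-Real.log ‖x - y‖) * σ y * σ x ≤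
          (1/2) * (∫ x : E2, |σ x|) *
              (∫ x : E2, |σ x| * Real.log (|σ x| / ∫ x' : E2, |σ x'|))
            + (C + Real.log (2 * S)) * (∫ x : E2, |σ x|) ^ 2 := by
  have hC := hls (KK + 1) (by linarith)
  refine ⟨KK + 1, by linarith [KK_nonneg], hC, ?_⟩
  rintro S hS σ hσ ⟨B, hB⟩ - hsupp hzero
  have bdd : ∀ (f : E2 → ℝ) (A : ℝ), Measurable f → (∀ x, ‖x‖ ≤ S → |f x| ≤ A) →
      (∀ x, σ x = 0 → f x = 0) → Integrable f := by
    intro f A hf hA hz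
    have h1 : IntegrableOn f (Metric.closedBall 0 S) := by
      refine Measure.integrableOn_of_bounded (M := A) ?_ hf.aestronglyMeasurable ?_
      · exact measure_closedBall_lt_top.ne
      · filter_upwards [ae_restrict_mem measurableSet_closedBall] with x hx
        exact hA x (by simpa using hx)
    refine (h1.integrable_indicator measurableSet_closedBall).congr ?_
    filter_upwards [hsupp] with x hx
    by_cases h : ‖x‖ ≤ S
    · simp [Set.indicator, h]
    · simp [Set.indicator, h, hz x (hx (not_le.mp h))]
  have hB0 : 0 ≤ B := (abs_nonneg _).trans (hB 0)
  have iσ : Integrable σ := bdd σ B hσ (fun x _ => hB x) (fun x h => h)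
  have iσa : Integrable (fun x => |σ x|) := iσ.abs
  set L := ∫ x : E2, |σ x| with hL
  -- kernel integrability
  have iq : Integrable (fun z : E2 × E2 => Real.log ‖z.1 - z.2‖ * |σ z.1| * |σ z.2|)
      ((volume : Measure E2).prod volume) := by
    have h1 := (iσa.convolution_integrand (ContinuousLinearMap.mul ℝ ℝ) (logq_int S)
      (μ := volume)).const_mul B
    refine h1.mono' (by fun_prop) ?_
    filter_upwards [Measure.quasiMeasurePreserving_fst.ae hsupp,
      Measure.quasiMeasurePreserving_snd.ae hsupp] with z h1 h2
    simp only [ContinuousLinearMap.mul_apply', norm_mul, Real.norm_eq_abs, abs_abs]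
    by_cases g2 : S < ‖z.2‖
    · simp [h2 g2]
    by_cases g1 : S < ‖z.1‖
    · simp only [h1 g1, abs_zero, mul_zero, zero_mul]
      have : 0 ≤ Set.indicator (Set.Iic (2 * S)) (fun t => |Real.log t|) ‖z.1 - z.2‖ :=
        Set.indicator_nonneg (fun _ _ => abs_nonneg _) _
      positivity
    have : ‖z.1 - z.2‖ ≤ 2 * S := (norm_sub_le _ _).trans (by linarith)
    rw [Set.indicator_of_mem (by simpa using this)]
    calc |Real.log ‖z.1 - z.2‖| * |σ z.1| * |σ z.2|
        ≤ |Real.log ‖z.1 - z.2‖| * B * |σ z.2| := by gcongr; exact hB _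
      _ = _ := by ring
  have key := hC (fun x => |σ x|) iσa (.of_forall fun x => abs_nonneg _)
    (by
      refine bdd _ (B * Real.log (1 + S ^ 2)) (by fun_prop) (fun x hx => ?_) (fun x h => by simp [h])
      rw [abs_mul, abs_abs]
      have : 0 ≤ Real.log (1 + ‖x‖ ^ 2) := Real.log_nonneg (by nlinarith [norm_nonneg x])
      rw [abs_of_nonneg this]
      gcongr
      exact hB x)
    (by
      have hc : Continuous (fun t : ℝ => |L * ((t / L) * Real.log (t / L))|) :=
        (continuous_const.mul (Real.continuous_mul_log.comp (continuous_id.div_const L))).abs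
      obtain ⟨A, hA⟩ := (isCompact_Icc (a := (0:ℝ)) (b := B)).bddAbove_image hc.continuousOn
      refine bdd _ A (by fun_prop) (fun x _ => ?_) (fun x h => by simp [h])
      rcases eq_or_ne L 0 with h | h
      · have := hA (Set.mem_image_of_mem _ (⟨le_rfl, hB0⟩ : (0:ℝ) ∈ Set.Icc 0 B))
        simpa [← hL, h] using this
      · have := hA (Set.mem_image_of_mem _ (⟨abs_nonneg _, hB x⟩ : |σ x| ∈ Set.Icc 0 B))
        simp only [← hL]
        rwa [← mul_assoc, mul_div_cancel₀ _ h] at this)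
    iq
  simp only [← hL] at key
  have iqs : Integrable (fun z : E2 × E2 => -Real.log ‖z.1 - z.2‖ * σ z.2 * σ z.1)
      ((volume : Measure E2).prod volume) := by
    refine iq.mono (by fun_prop) (.of_forall fun z => le_of_eq ?_)
    simp only [norm_mul, norm_neg, Real.norm_eq_abs, abs_abs]; ring
  have iqa : Integrable (fun z : E2 × E2 => Real.log ‖z.1 - z.2‖ * |σ z.2| * |σ z.1|)
      ((volume : Measure E2).prod volume) := iq.congr (.of_forall fun z => by ring)
  have ip : Integrable (fun z : E2 × E2 => σ z.1 * σ z.2)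
      ((volume : Measure E2).prod volume) := iσ.mul_prod iσ
  have ipa : Integrable (fun z : E2 × E2 => |σ z.1| * |σ z.2|)
      ((volume : Measure E2).prod volume) := iσa.mul_prod iσa
  have hle : ∀ᵐ z ∂((volume : Measure E2).prod volume),
      -Real.log ‖z.1 - z.2‖ * σ z.2 * σ z.1 + Real.log (2 * S) * (σ z.1 * σ z.2) ≤
      Real.log (2 * S) * (|σ z.1| * |σ z.2|) - Real.log ‖z.1 - z.2‖ * |σ z.2| * |σ z.1| := by
    filter_upwards [ne_ae, Measure.quasiMeasurePreserving_fst.ae hsupp,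
      Measure.quasiMeasurePreserving_snd.ae hsupp] with z h0 h1 h2
    by_cases g2 : S < ‖z.2‖
    · simp [h2 g2]
    by_cases g1 : S < ‖z.1‖
    · simp [h1 g1]
    have h3 : ‖z.1 - z.2‖ ≤ 2 * S := (norm_sub_le _ _).trans (by linarith)
    have h4 : 0 ≤ Real.log (2 * S) - Real.log ‖z.1 - z.2‖ :=
      sub_nonneg.mpr (Real.log_le_log h0 h3)
    have h5 : σ z.1 * σ z.2 ≤ |σ z.1| * |σ z.2| := by
      rw [← abs_mul]; exact le_abs_self _
    linarith [mul_le_mul_of_nonneg_left h5 h4]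
  have fin := integral_mono_ae (iqs.add (ip.const_mul _)) ((ipa.const_mul _).sub iqa) hle
  simp only [Pi.add_apply, Pi.sub_apply] at fin
  rw [integral_add iqs (ip.const_mul _), integral_sub (ipa.const_mul _) iqa, integral_const_mul,
    integral_const_mul, integral_prod_mul σ σ, integral_prod_mul (fun x => |σ x|) (fun x => |σ x|),
    hzero, integral_prod _ iqs, integral_prod _ iqa, ← hL] at fin
  linarith
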